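/- arXiv:0910.5374 — 3 statements merged into one kernel-verified Lean document; each statement's English description precedes it below -/
import Mathlib

section
/- The polynomial ring R[x] is right quasi-duo if and only if the quotient R[x]/J(R[x]) is a commutative ring. -/
/-- A ring is right quasi-duo if every maximal right ideal (a coatom in the
lattice of right ideals, i.e. submodules of `R` over `Rᵐᵒᵖ`) is two-sided. -/
def RightQuasiDuo (R : Type*) [Ring R] : Prop :=
  ∀ I : Submodule Rᵐᵒᵖ R, IsCoatom I → ∀ r x : R, x ∈ I → r * x ∈ I

/-- A ring is left quasi-duo if every maximal left ideal is two-sided. -/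
def LeftQuasiDuo (R : Type*) [Ring R] : Prop :=
  ∀ I : Submodule R R, IsCoatom I → ∀ r x : R, x ∈ I → x * r ∈ I

open Polynomial

namespace QD

universe u

theorem unit_swap {S : Type u} [Ring S] (a b : S) (h : IsUnit (1 + a * b)) : IsUnit (1 + b * a) := by
  obtain ⟨w, hw⟩ := h
  have h1 : (1 + a * b) * (↑w⁻¹ : S) = 1 := by rw [← hw]; simp
  have h2 : (↑w⁻¹ : S) * (1 + a * b) = 1 := by rw [← hw]; simp
  refine ⟨⟨1 + b * a, 1 - b * (↑w⁻¹ : S) * a, ?_, ?_⟩, rfl⟩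
  · have : (1 + b * a) * (1 - b * (↑w⁻¹ : S) * a) = 1 + b * a - b * ((1 + a * b) * (↑w⁻¹ : S)) * a := by
      noncomm_ring
    rw [this, h1]; noncomm_ring
  · have : (1 - b * (↑w⁻¹ : S) * a) * (1 + b * a) = 1 + b * a - b * ((↑w⁻¹ : S) * (1 + a * b)) * a := by
      noncomm_ring
    rw [this, h2]; noncomm_ring

/-- the right ideal generated by an element -/
def rspan {S : Type u} [Ring S] (z : S) : Submodule Sᵐᵒᵖ S where
  carrier := {y | ∃ s, y = z * s}
  add_mem' := by
    rintro _ _ ⟨s, rfl⟩ ⟨t, rfl⟩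
    exact ⟨s + t, by rw [mul_add]⟩
  zero_mem' := ⟨0, by simp⟩
  smul_mem' := by
    rintro c _ ⟨s, rfl⟩
    exact ⟨s * c.unop, by rw [← mul_assoc]; rfl⟩

theorem mul_mem_right' {S : Type u} [Ring S] (M : Submodule Sᵐᵒᵖ S) {a : S} (b : S) (h : a ∈ M) :
    a * b ∈ M := M.smul_mem (MulOpposite.op b) h

theorem eq_top_of_one {S : Type u} [Ring S] (M : Submodule Sᵐᵒᵖ S) (h : (1 : S) ∈ M) : M = ⊤ := by
  rw [eq_top_iff]
  intro x _
  simpa using mul_mem_right' M x h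

theorem exists_coatom {S : Type u} [Ring S] (z : S) (h : ∀ s, z * s ≠ 1) :
    ∃ M : Submodule Sᵐᵒᵖ S, IsCoatom M ∧ z ∈ M := by
  have : IsCoatomic (Submodule Sᵐᵒᵖ S) := by
    apply CompleteLattice.coatomic_of_top_compact
    have : (⊤ : Submodule Sᵐᵒᵖ S) = Submodule.span Sᵐᵒᵖ {1} := by
      symm
      exact eq_top_of_one _ (Submodule.mem_span_singleton_self 1)
    rw [this]
    exact Submodule.singleton_span_isCompactElement 1
  rcases eq_top_or_exists_le_coatom (rspan z) with h1 | ⟨M, hM, hle⟩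
  · have : (1 : S) ∈ rspan z := by rw [h1]; trivial
    obtain ⟨s, hs⟩ := this
    exact absurd hs.symm (h s)
  · exact ⟨M, hM, hle ⟨1, by simp⟩⟩

theorem one_eq_of_coatom {S : Type u} [Ring S] {M : Submodule Sᵐᵒᵖ S} (hM : IsCoatom M) {z : S}
    (hz : z ∉ M) : ∃ s, 1 - z * s ∈ M := by
  have h1 : M ⊔ rspan z = ⊤ := by
    apply hM.2
    refine lt_of_le_of_ne le_sup_left ?_
    intro h
    apply hz
    rw [h]
    exact (le_sup_right : rspan z ≤ _) ⟨1, by simp⟩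
  have h2 : (1 : S) ∈ M ⊔ rspan z := by rw [h1]; trivial
  obtain ⟨y, hy, _, ⟨s, rfl⟩, h⟩ := Submodule.mem_sup.1 h2
  exact ⟨s, by rw [← h]; simpa using hy⟩

theorem mem_jac_of {S : Type u} [Ring S] (z : S)
    (h : ∀ M : Submodule Sᵐᵒᵖ S, IsCoatom M → z ∈ M) :
    z ∈ Ideal.jacobson (⊥ : Ideal S) := by
  have key : ∀ s, ∃ w, (1 + z * s) * w = 1 := by
    intro s
    by_contra! hc
    obtain ⟨M, hM, hm⟩ := exists_coatom _ hc
    apply hM.1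
    apply eq_top_of_one
    have := M.sub_mem hm (mul_mem_right' M s (h M hM))
    simpa using this
  have hu : ∀ s, IsUnit (1 + z * s) := by
    intro s
    obtain ⟨w, hw⟩ := key s
    obtain ⟨v, hv⟩ := key (-(s * w))
    have h1 : 1 + z * (-(s * w)) = w := by
      have : 1 + z * (-(s * w)) = 1 - ((1 + z * s) * w) + w := by noncomm_ring
      rw [this, hw]; simp
    rw [h1] at hv
    have h2 : 1 + z * s = v := by
      calc 1 + z * s = (1 + z * s) * (w * v) := by rw [hv, mul_one]
        _ = v := by rw [← mul_assoc, hw, one_mul]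
    exact ⟨⟨1 + z * s, w, hw, by rw [h2, hv]⟩, rfl⟩
  rw [Ideal.mem_jacobson_iff]
  intro y
  obtain ⟨w, hw⟩ := unit_swap _ _ (hu y)
  refine ⟨↑w⁻¹, ?_⟩
  have : (↑w⁻¹ : S) * y * z + ↑w⁻¹ - 1 = ↑w⁻¹ * (1 + y * z) - 1 := by noncomm_ring
  rw [this, ← hw]
  simp

theorem mem_of_jac {S : Type u} [Ring S] (z : S) (h : z ∈ Ideal.jacobson (⊥ : Ideal S))
    (M : Submodule Sᵐᵒᵖ S) (hM : IsCoatom M) : z ∈ M := by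
  by_contra hz
  obtain ⟨s, hs⟩ := one_eq_of_coatom hM hz
  have key : ∀ y, ∃ w, w * (1 + y * z) = 1 := by
    intro y
    obtain ⟨w, hw⟩ := Ideal.mem_jacobson_iff.1 h y
    refine ⟨w, ?_⟩
    have h0 : w * y * z + w - 1 = 0 := by simpa using hw
    have : w * (1 + y * z) = (w * y * z + w - 1) + 1 := by noncomm_ring
    rw [this, h0, zero_add]
  obtain ⟨w, hw⟩ := key (-s)
  obtain ⟨v, hv⟩ := key (w * s)
  have h1 : 1 + w * s * z = w := by
    have : 1 + w * s * z = 1 - w * (1 + -s * z) + w := by noncomm_ring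
    rw [this, hw]; simp
  rw [h1] at hv
  have h2 : 1 + -s * z = v := by
    calc 1 + -s * z = (v * w) * (1 + -s * z) := by rw [hv, one_mul]
      _ = v := by rw [mul_assoc, hw, mul_one]
  have hu : IsUnit (1 + -s * z) := ⟨⟨1 + -s * z, w, by rw [h2, hv], hw⟩, rfl⟩
  obtain ⟨t, ht⟩ := unit_swap _ _ hu
  apply hM.1
  apply eq_top_of_one
  have h3 : (t : S) ∈ M := by rw [ht]; simpa [sub_eq_add_neg] using hs
  simpa using mul_mem_right' M (↑t⁻¹ : S) h3

theorem exists_div {S : Type u} [Ring S] (hS : RightQuasiDuo S) (M : Submodule Sᵐᵒᵖ S)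
    (hM : IsCoatom M) : ∃ (D : Type u) (_ : DivisionRing D) (φ : S →+* D),
      Function.Surjective φ ∧ ∀ s, φ s = 0 ↔ s ∈ M := by
  let I : Ideal S :=
    { carrier := M
      add_mem' := fun ha hb => M.add_mem ha hb
      zero_mem' := M.zero_mem
      smul_mem' := fun c x hx => hS M hM c x hx }
  have hI : ∀ s, s ∈ I ↔ s ∈ M := fun s => Iff.rfl
  have : I.IsTwoSided := ⟨fun b ha => mul_mem_right' M b ha⟩
  have hq : ∀ s, Ideal.Quotient.mk I s = 0 ↔ s ∈ M := fun s => by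
    rw [Ideal.Quotient.eq_zero_iff_mem, hI]
  have : Nontrivial (S ⧸ I) := by
    refine ⟨⟨Ideal.Quotient.mk I 1, 0, ?_⟩⟩
    rw [Ne, hq]
    exact fun h => hM.1 (eq_top_of_one _ h)
  have hr : ∀ a : S ⧸ I, a ≠ 0 → ∃ b, a * b = 1 := by
    intro a ha
    obtain ⟨s, rfl⟩ := Ideal.Quotient.mk_surjective a
    rw [Ne, hq] at ha
    obtain ⟨t, ht⟩ := one_eq_of_coatom hM ha
    refine ⟨Ideal.Quotient.mk I t, ?_⟩
    rw [← hq, map_sub, map_one, map_mul, sub_eq_zero] at ht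
    exact ht.symm
  have hu : ∀ a : S ⧸ I, IsUnit a ∨ a = 0 := by
    intro a
    by_cases ha : a = 0
    · exact Or.inr ha
    left
    obtain ⟨b, hb⟩ := hr a ha
    have hb0 : b ≠ 0 := by rintro rfl; simp at hb
    obtain ⟨c, hc⟩ := hr b hb0
    have : a = c := by
      calc a = a * (b * c) := by rw [hc, mul_one]
        _ = c := by rw [← mul_assoc, hb, one_mul]
    exact ⟨⟨a, b, hb, by rw [this, hc]⟩, rfl⟩
  exact ⟨S ⧸ I, DivisionRing.ofIsUnitOrEqZero hu, Ideal.Quotient.mk I,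
    Ideal.Quotient.mk_surjective, hq⟩

section core
variable {R : Type u} [Ring R] {D : Type u} [DivisionRing D] (φ : R[X] →+* D) (β : D)

/-- left evaluation -/
noncomputable def ev (p : R[X]) : D := p.sum fun i r => β ^ i * φ (C r)

theorem ev_add (p q : R[X]) : ev φ β (p + q) = ev φ β p + ev φ β q := by
  unfold ev
  apply Polynomial.sum_add_index
  · intro i; simp
  · intro i a b; simp [mul_add]

theorem ev_mon (n : ℕ) (r : R) : ev φ β (monomial n r) = β ^ n * φ (C r) := by
  unfold ev
  apply Polynomial.sum_monomial_index
  simp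

theorem ev_zero : ev φ β 0 = 0 := by simp [ev]

theorem ev_C (r : R) : ev φ β (C r) = φ (C r) := by
  rw [← monomial_zero_left, ev_mon]; simp

theorem ev_one : ev φ β 1 = 1 := by
  rw [← C_1, ev_C]; simp

theorem ev_mul_C (p : R[X]) (r : R) : ev φ β (p * C r) = ev φ β p * φ (C r) := by
  induction p using Polynomial.induction_on' with
  | add p q hp hq => rw [add_mul, ev_add, ev_add, hp, hq, add_mul]
  | monomial n a => rw [monomial_mul_C, ev_mon, ev_mon, C_mul, map_mul, mul_assoc]

theorem ev_mul_X_pow (p : R[X]) (k : ℕ) : ev φ β (p * X ^ k) = β ^ k * ev φ β p := by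
  induction p using Polynomial.induction_on' with
  | add p q hp hq => rw [add_mul, ev_add, ev_add, hp, hq, mul_add]
  | monomial n a =>
    rw [monomial_mul_X_pow, ev_mon, ev_mon, ← mul_assoc, ← pow_add, add_comm]

/-- kernel of left evaluation -/
def kev : Submodule R[X]ᵐᵒᵖ R[X] where
  carrier := {p | ev φ β p = 0}
  add_mem' := by
    intro p q hp hq
    simp only [Set.mem_ofPred_eq] at *
    rw [ev_add, hp, hq, add_zero]
  zero_mem' := ev_zero φ β
  smul_mem' := by
    intro c p hp
    simp only [Set.mem_ofPred_eq] at *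
    change ev φ β (p * c.unop) = 0
    induction c.unop using Polynomial.induction_on' with
    | add q r hq hr => rw [mul_add, ev_add, hq, hr, add_zero]
    | monomial n a =>
      rw [← C_mul_X_pow_eq_monomial, ← mul_assoc, ev_mul_X_pow, ev_mul_C, hp]; simp

theorem mem_kev (p : R[X]) : p ∈ kev φ β ↔ ev φ β p = 0 := Iff.rfl

theorem core (hS : RightQuasiDuo R[X]) (hφ : Function.Surjective φ) (u v d : R)
    (hd : d = u * v - v * u) (hx : φ (C d) * φ X = 1) : False := by
  have hd0 : φ (C d) ≠ 0 := by intro h; rw [h, zero_mul] at hx; exact zero_ne_one hx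
  have hX0 : φ X ≠ 0 := by intro h; rw [h, mul_zero] at hx; exact zero_ne_one hx
  have hXc : ∀ y, Commute (φ X) y := by
    intro y
    obtain ⟨s, rfl⟩ := hφ y
    exact (Polynomial.commute_X s).map φ
  have hdinv : φ (C d) = (φ X)⁻¹ := eq_inv_of_mul_eq_one_left hx
  have hdc : ∀ y, Commute (φ (C d)) y := by
    intro y; rw [hdinv]; exact (hXc y).inv_left₀
  have hdd : φ (C d) = φ (C u) * φ (C v) - φ (C v) * φ (C u) := by
    rw [hd]; simp
  have hu0 : φ (C u) ≠ 0 := by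
    intro h; rw [h] at hdd; simp at hdd; exact hd0 (by simpa using hdd)
  set b := d * u with hb
  have hbφ : φ (C b) = φ (C d) * φ (C u) := by rw [hb, C_mul, map_mul]
  have hb0 : φ (C b) ≠ 0 := by rw [hbφ]; exact mul_ne_zero hd0 hu0
  set β := (φ (C b))⁻¹ with hβ
  have hclear : ∀ s : R[X], ∃ (m : ℕ) (t : R), φ s * φ (C d) ^ m = φ (C t) := by
    intro s
    induction s using Polynomial.induction_on' with
    | add p q hp hq =>
      obtain ⟨m, t, h⟩ := hp
      obtain ⟨m', t', h'⟩ := hq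
      refine ⟨m + m', t * d ^ m' + t' * d ^ m, ?_⟩
      have e1 : φ p * φ (C d) ^ (m + m') = φ (C t) * φ (C d) ^ m' := by
        rw [pow_add, ← mul_assoc, h]
      have e2 : φ q * φ (C d) ^ (m + m') = φ (C t') * φ (C d) ^ m := by
        rw [add_comm, pow_add, ← mul_assoc, h']
      rw [map_add, add_mul, e1, e2]
      simp
    | monomial n a =>
      refine ⟨n, a, ?_⟩
      rw [← C_mul_X_pow_eq_monomial, map_mul, map_pow, mul_assoc, ← (hXc _).mul_pow,
        (hXc _).eq, hx, one_pow, mul_one]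
  have hco : IsCoatom (kev φ β) := by
    constructor
    · intro h
      have : (1 : R[X]) ∈ kev φ β := by rw [h]; trivial
      rw [mem_kev, ev_one] at this
      exact one_ne_zero this
    · intro N hN
      obtain ⟨hle, y, hyN, hy⟩ := SetLike.lt_iff_le_and_exists.1 hN
      rw [mem_kev] at hy
      obtain ⟨s, hs⟩ := hφ (ev φ β y)⁻¹
      obtain ⟨m, t, ht⟩ := hclear s
      apply eq_top_of_one
      have h1 : y * (C t * C (u ^ m) * X ^ m) ∈ N := mul_mem_right' N _ hyN
      have h2 : ev φ β (y * (C t * C (u ^ m) * X ^ m)) = 1 := by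
        rw [← mul_assoc, ← mul_assoc, ev_mul_X_pow, ev_mul_C, ev_mul_C, ← ht, hs, ← mul_assoc (ev φ β y),
          mul_inv_cancel₀ hy, one_mul, C_pow, map_pow, ← (hdc _).mul_pow, ← hbφ, hβ, inv_pow,
          inv_mul_cancel₀ (pow_ne_zero _ hb0)]
      have h3 : 1 + y * (C t * C (u ^ m) * X ^ m) * C (-1) ∈ kev φ β := by
        rw [mem_kev, ev_add, ev_mul_C, h2, ev_one]; simp
      have h4 := N.sub_mem (hle h3) (mul_mem_right' N (C (-1)) h1)
      simpa using h4
  have hmem : 1 + C (-b) * X ∈ kev φ β := by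
    rw [mem_kev, ev_add, ev_one, ← pow_one X, ev_mul_X_pow, ev_C, C_neg, map_neg, pow_one,
      mul_neg, hβ, inv_mul_cancel₀ hb0]; simp
  have hm2 := hS _ hco (C v) _ hmem
  have hm3 := mul_mem_right' _ (C v) hmem
  have hm4 := (kev φ β).sub_mem hm2 hm3
  have e : C v * (1 + C (-b) * X) - (1 + C (-b) * X) * C v = C (b * v - v * b) * X := by
    have : C (-b) * X * C v = C (-b) * C v * X := by
      rw [mul_assoc, X_mul_C, mul_assoc]
    rw [mul_add, add_mul, this]
    simp only [C_neg, C_sub, C_mul]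
    noncomm_ring
  rw [e, mem_kev, ← pow_one X, ev_mul_X_pow, ev_C, pow_one] at hm4
  have h5 : φ (C (b * v - v * b)) = 0 := by
    rcases mul_eq_zero.1 hm4 with h | h
    · exact absurd h (inv_ne_zero hb0)
    · exact h
  have h6 : φ (C (b * v - v * b)) = φ (C d) * φ (C d) := by
    nth_rewrite 2 [hdd]
    simp only [hb, C_sub, C_mul, map_sub, map_mul]
    rw [mul_sub, ← mul_assoc (φ (C v)),
      ← (hdc _).eq, mul_assoc, mul_assoc]
  rw [h6] at h5
  exact mul_ne_zero hd0 hd0 h5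

end core

theorem nilp {R : Type u} [Ring R] (d : R) (s : R[X]) (h : (1 - C d * X) * s = 1) :
    ∃ n, d ^ n = 0 := by
  have hc : ∀ n, s.coeff n = d ^ n := by
    have hs : s = 1 + C d * (s * X) := by
      rw [← sub_eq_iff_eq_add, ← h, sub_mul, one_mul, mul_assoc, ← X_mul]
    intro n
    induction n with
    | zero => rw [hs]; simp
    | succ n ih =>
      rw [hs, coeff_add, coeff_C_mul, coeff_mul_X, ih, pow_succ']
      simp [coeff_one]
  refine ⟨s.natDegree + 1, ?_⟩
  rw [← hc]
  exact coeff_eq_zero_of_natDegree_lt (Nat.lt_succ_self _)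

theorem const_mem {R : Type u} [Ring R] (hS : RightQuasiDuo R[X]) (M : Submodule R[X]ᵐᵒᵖ R[X])
    (hM : IsCoatom M) (u v : R) : C (u * v - v * u) ∈ M := by
  by_contra hd
  obtain ⟨D, _, φ, hφ, hk⟩ := exists_div hS M hM
  obtain ⟨M', hM', hm⟩ := exists_coatom (1 - C (u * v - v * u) * X : R[X]) (by
    intro s hs
    obtain ⟨n, hn⟩ := nilp _ s hs
    apply hd
    rw [← hk]
    have : φ (C (u * v - v * u)) ^ n = 0 := by
      rw [← map_pow, ← C_pow, hn]; simp
    exact eq_zero_of_pow_eq_zero this)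
  obtain ⟨D', _, φ', hφ', hk'⟩ := exists_div hS M' hM'
  rw [← hk', map_sub, map_one, map_mul, sub_eq_zero] at hm
  exact core φ' hS hφ' u v _ rfl hm.symm

end QD

theorem stmt17 (R : Type*) [Ring R] :
    RightQuasiDuo (Polynomial R) ↔
      ∀ f g : Polynomial R,
        f * g - g * f ∈ Ideal.jacobson (⊥ : Ideal (Polynomial R)) := by
  constructor
  · intro hS f g
    apply QD.mem_jac_of
    intro M hM
    obtain ⟨D, _, φ, hφ, hk⟩ := QD.exists_div hS M hM
    rw [← hk, map_sub, map_mul, map_mul, sub_eq_zero]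
    have hX : ∀ p : R[X], ∀ n, Commute (φ X ^ n) (φ p) := fun p n =>
      ((Polynomial.commute_X p).map φ).pow_left n
    have hC : ∀ u v : R, Commute (φ (C u)) (φ (C v)) := by
      intro u v
      have := (hk _).2 (QD.const_mem hS M hM u v)
      rw [C_sub, map_sub, C_mul, C_mul, map_mul, map_mul, sub_eq_zero] at this
      exact this
    change Commute (φ f) (φ g)
    induction f using Polynomial.induction_on' with
    | add p q hp hq => rw [map_add]; exact hp.add_left hq
    | monomial n a =>
      rw [← C_mul_X_pow_eq_monomial, map_mul, map_pow]
      refine Commute.mul_left ?_ (hX g n)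
      induction g using Polynomial.induction_on' with
      | add p q hp hq => rw [map_add]; exact hp.add_right hq
      | monomial m b =>
        rw [← C_mul_X_pow_eq_monomial, map_mul, map_pow]
        exact (hC a b).mul_right (hX _ m).symm
  · intro h I hI r x hx
    have h1 := QD.mem_of_jac _ (h r x) I hI
    have h2 := I.add_mem h1 (QD.mul_mem_right' I r hx)
    simpa using h2
end

section
/- The polynomial ring R[x] is right quasi-duo if and only if it is left quasi-duo. -/
open Polynomial

theorem qd_quot.{u} {S : Type u} [Ring S] (h : LeftQuasiDuo S) (I : Ideal S) (hI : IsCoatom I) :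
    ∃ (D : Type u) (_ : Ring D) (_ : IsDomain D) (φ : S →+* D),
      Function.Surjective φ ∧ ∀ s, φ s = 0 ↔ s ∈ I := by
  have : I.IsTwoSided := ⟨fun {a} b ha => h I hI b a ha⟩
  have hne : I ≠ ⊤ := hI.1
  have hz : ∀ s, Ideal.Quotient.mk I s = 0 ↔ s ∈ I := fun s => Ideal.Quotient.eq_zero_iff_mem
  have : Nontrivial (S ⧸ I) := by
    refine ⟨⟨1, 0, fun h1 => hne ?_⟩⟩
    rw [Ideal.eq_top_iff_one, ← hz, map_one, h1]
  have : NoZeroDivisors (S ⧸ I) := by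
    refine ⟨?_⟩
    intro a b hab
    obtain ⟨s, rfl⟩ := Ideal.Quotient.mk_surjective a
    obtain ⟨t, rfl⟩ := Ideal.Quotient.mk_surjective b
    by_cases hs : s ∈ I
    · left; exact (hz s).2 hs
    right
    have hlt : I < I ⊔ Ideal.span {s} := by
      refine lt_of_le_of_ne le_sup_left fun he => hs ?_
      rw [he]
      exact (le_sup_right : Ideal.span {s} ≤ _) (Ideal.mem_span_singleton_self s)
    have htop := hI.2 _ hlt
    have h1 : (1 : S) ∈ I ⊔ Ideal.span {s} := htop ▸ Submodule.mem_top
    obtain ⟨i, hi, y, hy, hiy⟩ := Submodule.mem_sup.1 h1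
    obtain ⟨r, rfl⟩ := Ideal.mem_span_singleton'.1 hy
    have h2 : Ideal.Quotient.mk I r * Ideal.Quotient.mk I s = 1 := by
      rw [← map_mul, ← map_one (Ideal.Quotient.mk I), ← hiy, map_add, (hz i).2 hi, zero_add]
    calc Ideal.Quotient.mk I t = (Ideal.Quotient.mk I r * Ideal.Quotient.mk I s) * Ideal.Quotient.mk I t := by
          rw [h2, one_mul]
      _ = 0 := by rw [mul_assoc, hab, mul_zero]
  exact ⟨S ⧸ I, inferInstance, NoZeroDivisors.to_isDomain _, Ideal.Quotient.mk I,
    Ideal.Quotient.mk_surjective, hz⟩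

theorem qd_noninv.{u} {S : Type u} [Ring S] (h : LeftQuasiDuo S) (s : S) (hs : ∀ r, r * s ≠ 1) :
    ∃ (D : Type u) (_ : Ring D) (_ : IsDomain D) (φ : S →+* D),
      Function.Surjective φ ∧ φ s = 0 := by
  have hne : Ideal.span {s} ≠ ⊤ := by
    intro he
    have h1 := (Ideal.eq_top_iff_one _).1 he
    obtain ⟨r, hr⟩ := Ideal.mem_span_singleton'.1 h1
    exact hs r hr
  obtain ⟨M, hM, hle⟩ := Ideal.exists_le_maximal _ hne
  obtain ⟨D, i1, i2, φ, h1, h2⟩ := qd_quot h M hM.1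
  exact ⟨D, i1, i2, φ, h1, (h2 s).2 (hle (Ideal.mem_span_singleton_self s))⟩

theorem qd_surj {S T : Type*} [Ring S] [Ring T] (h : LeftQuasiDuo S) (f : S →+* T)
    (hf : Function.Surjective f) : LeftQuasiDuo T := by
  intro I hI r x hx
  have : Ideal.IsMaximal I := ⟨hI⟩
  have hm : Ideal.IsMaximal (Ideal.comap f I) := Ideal.comap_isMaximal_of_surjective f hf
  obtain ⟨r, rfl⟩ := hf r
  obtain ⟨x, rfl⟩ := hf x
  have := h _ hm.1 r x hx
  rw [← map_mul]
  exact this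

theorem deg_noninv {A : Type*} [Ring A] [IsDomain A] (c d : A) (hc : c ≠ 0) (r : A[X]) :
    r * (C c * X + C d) ≠ 1 := by
  intro h
  have hd : (C c * X + C d).natDegree = 1 := natDegree_linear hc
  have h0 : (C c * X + C d) ≠ 0 := by
    intro h0; rw [h0] at hd; simp at hd
  have hr : r ≠ 0 := by rintro rfl; simp at h
  have := congrArg natDegree h
  rw [natDegree_mul hr h0, hd, natDegree_one] at this
  omega

/-- Step with central commutator. -/
theorem step_central {A : Type*} [Ring A] [IsDomain A] (h : LeftQuasiDuo A[X]) (a b : A)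
    (hc : ∀ r, (a * b - b * a) * r = r * (a * b - b * a)) : a * b - b * a = 0 := by
  set c := a * b - b * a with hcdef
  by_contra hne
  obtain ⟨D, i1, i2, φ, -, hφ⟩ := qd_noninv h _ (deg_noninv c (-1 - a * c) hne)
  have e : φ (C c) * φ X + (-1 - φ (C a) * φ (C c)) = 0 := by
    simpa using hφ
  have hX : ∀ r, φ X * φ (C r) = φ (C r) * φ X := fun r => by
    rw [← map_mul, ← map_mul, X_mul_C]
  have hcc : ∀ r, φ (C c) * φ (C r) = φ (C r) * φ (C c) := fun r => by
    simp only [← map_mul, hc]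
  have hc' : φ (C c) = φ (C a) * φ (C b) - φ (C b) * φ (C a) := by simp [hcdef]
  have e1 : φ (C c) * (φ X - φ (C a)) = 1 := by
    rw [mul_sub, hcc a]
    rw [← sub_eq_zero, ← e]; abel
  have hc0 : φ (C c) ≠ 0 := by
    intro h0; rw [h0, zero_mul] at e1; exact zero_ne_one e1
  have e2 : φ (C c) * ((φ X - φ (C a)) * φ (C b) - φ (C b) * (φ X - φ (C a))) = 0 := by
    rw [mul_sub, ← mul_assoc, e1, ← mul_assoc, hcc b, mul_assoc, e1]; simp
  have e3 := (mul_eq_zero.1 e2).resolve_left hc0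
  apply hc0
  rw [sub_mul, mul_sub, hX b] at e3
  rw [hc', ← neg_eq_zero, ← e3]
  abel

theorem dom_comm {A : Type*} [Ring A] [IsDomain A] (h : LeftQuasiDuo A[X]) (a b : A) :
    a * b - b * a = 0 := by
  set c := a * b - b * a with hcdef
  by_contra hne
  obtain ⟨D, i1, i2, φ, -, hφ⟩ := qd_noninv h _ (deg_noninv c (-1) hne)
  have e : φ (C c) * φ X = 1 := by
    have : φ (C c) * φ X + (-1) = 0 := by simpa using hφ
    rwa [add_neg_eq_zero] at this
  have hX : ∀ r, φ X * φ (C r) = φ (C r) * φ X := fun r => by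
    rw [← map_mul, ← map_mul, X_mul_C]
  have hc0 : φ (C c) ≠ 0 := by
    intro h0; rw [h0, zero_mul] at e; exact zero_ne_one e
  let ψ : A →+* D := φ.comp C
  have hsurj : Function.Surjective (Polynomial.mapRingHom ψ.rangeRestrict) :=
    Polynomial.map_surjective _ ψ.rangeRestrict_surjective
  have hB : LeftQuasiDuo (ψ.range)[X] := qd_surj h _ hsurj
  have key := step_central hB (ψ.rangeRestrict a) (ψ.rangeRestrict b) ?_
  · rw [← map_mul, ← map_mul, ← map_sub] at key
    exact hc0 (congrArg Subtype.val key)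
  · rw [← map_mul, ← map_mul, ← map_sub, ← hcdef]
    intro r
    obtain ⟨r, rfl⟩ := ψ.rangeRestrict_surjective r
    apply Subtype.ext
    change φ (C c) * φ (C r) = φ (C r) * φ (C c)
    calc φ (C c) * φ (C r) = φ (C c) * φ (C r) * (φ X * φ (C c)) := by rw [hX, e, mul_one]
      _ = φ (C c) * (φ (C r) * φ X) * φ (C c) := by simp only [mul_assoc]
      _ = φ (C c) * φ X * φ (C r) * φ (C c) := by rw [← hX]; simp only [mul_assoc]
      _ = _ := by rw [e, one_mul]

theorem comm_mem {R : Type*} [Ring R] (h : LeftQuasiDuo R[X]) (I : Ideal R[X])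
    (hI : IsCoatom I) (f g : R[X]) : f * g - g * f ∈ I := by
  obtain ⟨D, i1, i2, φ, -, hφ⟩ := qd_quot h I hI
  rw [← hφ, map_sub, map_mul, map_mul, sub_eq_zero]
  have hX : ∀ p, Commute (φ X) (φ p) := fun r => by
    change _ * _ = _ * _
    rw [← map_mul, ← map_mul, X_mul]
  let ψ : R →+* D := φ.comp C
  have hsurj : Function.Surjective (Polynomial.mapRingHom ψ.rangeRestrict) :=
    Polynomial.map_surjective _ ψ.rangeRestrict_surjective
  have hB : LeftQuasiDuo (ψ.range)[X] := qd_surj h _ hsurj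
  have hCC : ∀ a b, Commute (φ (C a)) (φ (C b)) := fun a b => by
    have := dom_comm hB (ψ.rangeRestrict a) (ψ.rangeRestrict b)
    exact congrArg Subtype.val (sub_eq_zero.1 this)
  have hgen : ∀ (d : D), (∀ a, Commute d (φ (C a))) → Commute d (φ X) →
      ∀ p, Commute d (φ p) := by
    intro d h1 h2 p
    induction p using Polynomial.induction_on' with
    | add p q hp hq => rw [map_add]; exact hp.add_right hq
    | monomial n a =>
      rw [← C_mul_X_pow_eq_monomial, map_mul, map_pow]
      exact (h1 a).mul_right (h2.pow_right n)
  exact hgen (φ f) (fun a => (hgen (φ (C a)) (hCC a) (hX _).symm f).symm) (hX f).symm g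

/-- Left-right symmetric: commutators lie in the Jacobson radical. -/
def CommJ (S : Type*) [Ring S] : Prop := ∀ f g r : S, IsUnit (1 - r * (f * g - g * f))

theorem commJ_of_mem {S : Type*} [Ring S]
    (h : ∀ I : Ideal S, IsCoatom I → ∀ f g, f * g - g * f ∈ I) : CommJ S := by
  intro f g r
  have hleft : ∀ r, ∃ u, u * (1 - r * (f * g - g * f)) = 1 := by
    intro r
    by_contra hno
    have hne : Ideal.span {1 - r * (f * g - g * f)} ≠ ⊤ := by
      intro he
      have h1 := (Ideal.eq_top_iff_one _).1 he
      obtain ⟨u, hu⟩ := Ideal.mem_span_singleton'.1 h1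
      exact hno ⟨u, hu⟩
    obtain ⟨M, hM, hle⟩ := Ideal.exists_le_maximal _ hne
    have h1 := hle (Ideal.mem_span_singleton_self _)
    have h2 := M.mul_mem_left r (h M hM.1 f g)
    apply hM.ne_top
    rw [Ideal.eq_top_iff_one]
    simpa using M.add_mem h1 h2
  obtain ⟨u, hu⟩ := hleft r
  obtain ⟨v, hv⟩ := hleft (-(u * r))
  have hu' : 1 - -(u * r) * (f * g - g * f) = u := by
    have : u - u * (r * (f * g - g * f)) = 1 := by rw [← hu]; noncomm_ring
    rw [neg_mul, sub_neg_eq_add, mul_assoc]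
    nth_rw 1 [← this]
    abel
  rw [hu'] at hv
  have hvx : v = 1 - r * (f * g - g * f) := left_inv_eq_right_inv hv hu
  exact ⟨⟨_, u, hvx ▸ hv, hu⟩, rfl⟩

theorem lqd_of_commJ {S : Type*} [Ring S] (h : CommJ S) : LeftQuasiDuo S := by
  intro I hI r x hx
  have hmem : x * r - r * x ∈ I := by
    by_contra hs
    set s := x * r - r * x with hsd
    have hlt : I < I ⊔ Ideal.span {s} := by
      refine lt_of_le_of_ne le_sup_left fun he => hs ?_
      rw [he]
      exact (le_sup_right : Ideal.span {s} ≤ _) (Ideal.mem_span_singleton_self s)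
    have htop := hI.2 _ hlt
    have h1 : (1 : S) ∈ I ⊔ Ideal.span {s} := htop ▸ Submodule.mem_top
    obtain ⟨i, hi, y, hy, hiy⟩ := Submodule.mem_sup.1 h1
    obtain ⟨t, rfl⟩ := Ideal.mem_span_singleton'.1 hy
    have hu := h x r t
    rw [← hsd, ← hiy, add_sub_cancel_right] at hu
    exact hI.1 (Ideal.eq_top_of_isUnit_mem I hi hu)
  have := I.add_mem hmem (Ideal.mul_mem_left I r hx)
  simpa using this

theorem lqd_iff {R : Type*} [Ring R] : LeftQuasiDuo R[X] ↔ CommJ R[X] :=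
  ⟨fun h => commJ_of_mem (comm_mem h), lqd_of_commJ⟩

theorem unit_swap {S : Type*} [Ring S] (a b : S) (h : IsUnit (1 - a * b)) :
    IsUnit (1 - b * a) := by
  obtain ⟨⟨_, v, h1, h2⟩, rfl⟩ := h
  refine ⟨⟨1 - b * a, 1 + b * v * a, ?_, ?_⟩, rfl⟩
  · have : (1 - b * a) * (1 + b * v * a) = 1 - b * a + b * ((1 - a * b) * v) * a := by noncomm_ring
    rw [this, h1]; noncomm_ring
  · have : (1 + b * v * a) * (1 - b * a) = 1 - b * a + b * (v * (1 - a * b)) * a := by noncomm_ring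
    rw [this, h2]; noncomm_ring

open MulOpposite in
theorem commJ_op {S : Type*} [Ring S] (h : CommJ S) : CommJ Sᵐᵒᵖ := by
  intro f g r
  have := unit_swap _ _ (h g.unop f.unop r.unop)
  have := this.op
  simpa using this

theorem commJ_equiv {S T : Type*} [Ring S] [Ring T] (e : S ≃+* T) (h : CommJ S) : CommJ T := by
  intro f g r
  have := (h (e.symm f) (e.symm g) (e.symm r)).map e
  simpa using this

open MulOpposite in
/-- Right ideals of `S` versus left ideals of the opposite ring. -/
def opIdealIso (S : Type*) [Ring S] : Submodule Sᵐᵒᵖ S ≃o Submodule Sᵐᵒᵖ Sᵐᵒᵖ :=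
  Submodule.orderIsoMapComap
    ({ opAddEquiv (α := S) with map_smul' := fun r x => by simp } : S ≃ₗ[Sᵐᵒᵖ] Sᵐᵒᵖ)

open MulOpposite in
theorem mem_opIdealIso {S : Type*} [Ring S] (I : Submodule Sᵐᵒᵖ S) (x : S) :
    op x ∈ opIdealIso S I ↔ x ∈ I := by
  constructor
  · rintro ⟨y, hy, hxy⟩
    have : y = x := op_injective hxy
    exact this ▸ hy
  · intro hx
    exact ⟨x, hx, rfl⟩

open MulOpposite in
theorem rqd_iff_op {S : Type*} [Ring S] : RightQuasiDuo S ↔ LeftQuasiDuo Sᵐᵒᵖ := by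
  constructor
  · intro h J hJ r x hx
    obtain ⟨I, rfl⟩ := (opIdealIso S).surjective J
    rw [OrderIso.isCoatom_iff] at hJ
    have hx' : unop x ∈ I := (mem_opIdealIso I _).1 (by simpa using hx)
    exact (mem_opIdealIso I (unop r * unop x)).2 (h I hJ _ _ hx')
  · intro h I hI r x hx
    have := h (opIdealIso S I) ((OrderIso.isCoatom_iff _ _).2 hI) (op r) (op x)
      ((mem_opIdealIso I x).2 hx)
    exact (mem_opIdealIso I (r * x)).1 this

theorem rqd_iff {R : Type*} [Ring R] : RightQuasiDuo R[X] ↔ CommJ R[X] := by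
  rw [rqd_iff_op]
  constructor
  · intro h
    have h1 : LeftQuasiDuo (Rᵐᵒᵖ)[X] :=
      qd_surj h (opRingEquiv R).toRingHom (opRingEquiv R).surjective
    have h2 : CommJ (R[X])ᵐᵒᵖ := commJ_equiv (opRingEquiv R).symm (lqd_iff.1 h1)
    exact commJ_equiv (RingEquiv.opOp R[X]).symm (commJ_op h2)
  · intro h
    exact lqd_of_commJ (commJ_op h)

theorem stmt18 (R : Type*) [Ring R] :
    RightQuasiDuo (Polynomial R) ↔ LeftQuasiDuo (Polynomial R) := by
  rw [rqd_iff, lqd_iff]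
end

section
/- The Laurent polynomial ring R[x, x^{-1}] is right quasi-duo if and only if R[x, x^{-1}]/J(R[x, x^{-1}]) is commutative, and this holds if and only if R[x, x^{-1}] is left quasi-duo. -/
section Core
open Polynomial

theorem erase_lt {A : Type*} [Ring A] (p : A[X]) (n : ℕ) (h : p.degree < (n + 1 : ℕ)) :
    (p.erase n).degree < n := by
  rw [degree_lt_iff_coeff_zero] at h ⊢
  intro m hm
  rw [coeff_erase]
  split_ifs with h1
  · rfl
  · exact h m (by omega)

theorem core_alg {A D : Type*} [Ring A] [DivisionRing D] (ι : A →+* D)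
    (hι : Function.Injective ι) (t : D) (ht : t ≠ 0) (hc : ∀ a, Commute (ι a) t)
    (hspan : ∀ W : AddSubgroup D, (∀ a, ι a ∈ W) → (∀ w ∈ W, t * w ∈ W) →
      (∀ w ∈ W, t⁻¹ * w ∈ W) → ∀ d, d ∈ W) :
    ∃ J : A → Prop, (∃ y, J y ∧ y ≠ 0) ∧ (∀ y a, J y → J (y * a)) ∧
      ∀ y, J y → ∀ d, d ≠ 0 → ∃ (k : ℕ) (a : A), y ^ k = d * a := by
  have hnt : Nontrivial A := ⟨0, 1, fun h => by simpa using congrArg ι h⟩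
  let ev : A[X] →+* D := eval₂RingHom' ι t hc
  have evC : ∀ a, ev (C a) = ι a := fun a => by simp [ev, eval₂RingHom']
  have evX : ev X = t := by simp [ev, eval₂RingHom']
  have hti : ∀ a, Commute (ι a) t⁻¹ := fun a => (hc a).inv_right₀
  have hex : ∃ p : A[X], p ≠ 0 ∧ ev p = 0 := by
    by_cases h1 : 1 + t = 0
    · refine ⟨1 + X, ?_, by simp [evX, h1]⟩
      intro h
      simpa [coeff_one] using congrArg (fun p => coeff p 1) h
    · let W : AddSubgroup D :=
        { carrier := {d | ∃ (k : ℕ) (p : A[X]), t ^ k * d = ev p}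
          zero_mem' := ⟨0, 0, by simp⟩
          add_mem' := by
            rintro a b ⟨k, p, hp⟩ ⟨l, q, hq⟩
            refine ⟨k + l, X ^ l * p + X ^ k * q, ?_⟩
            rw [map_add, map_mul, map_mul, map_pow, map_pow, evX, ← hp, ← hq, mul_add,
              ← mul_assoc, ← mul_assoc, ← pow_add, ← pow_add, add_comm l k]
          neg_mem' := by
            rintro a ⟨k, p, hp⟩
            exact ⟨k, -p, by rw [map_neg, ← hp, mul_neg]⟩ }
      obtain ⟨k, p, hp⟩ := hspan W (fun a => ⟨0, C a, by simp [evC]⟩)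
        (by
          rintro w ⟨k, p, hp⟩
          exact ⟨k, X * p, by
            rw [map_mul, ← hp, evX, ← mul_assoc, ← mul_assoc, ← pow_succ, ← pow_succ']⟩)
        (by
          rintro w ⟨k, p, hp⟩
          exact ⟨k + 1, p, by rw [← hp, pow_succ, mul_assoc, ← mul_assoc t, mul_inv_cancel₀ ht, one_mul]⟩)
        ((1 + t)⁻¹)
      refine ⟨p * (1 + X) - X ^ k, ?_, ?_⟩
      · intro h
        have h2 : eval (-1 : A) (p * (X - C (-1)) - X ^ k) = 0 := by
          have : (1 + X : A[X]) = X - C (-1) := by simp [add_comm]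
          rw [← this, h]; simp
        rw [eval_sub, mul_sub, eval_sub, eval_mul_X] at h2
        rw [eval_mul_C_of_commute] at h2
        · rw [← one_mul (X ^ k), eval_mul_X_pow, eval_one, one_mul, mul_neg_one,
            sub_self, zero_sub, neg_eq_zero] at h2
          have h3 : IsUnit ((-1 : A) ^ k) := (isUnit_one.neg).pow k
          rw [h2] at h3
          exact not_isUnit_zero h3
        · simp
      · rw [map_sub, map_mul, ← hp, map_add, map_one, evX, map_pow, evX, mul_assoc,
          inv_mul_cancel₀ h1, mul_one, sub_self]
  classical
  have hex' : ∃ n, ∃ p : A[X], p ≠ 0 ∧ ev p = 0 ∧ p.natDegree = n := by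
    obtain ⟨p, h1, h2⟩ := hex
    exact ⟨_, p, h1, h2, rfl⟩
  obtain ⟨f, hf0, hfe, hfn⟩ := Nat.find_spec hex'
  have hmin : ∀ p : A[X], p.degree < f.degree → ev p = 0 → p = 0 := by
    intro p hp he
    by_contra h
    exact Nat.find_min hex' (m := p.natDegree)
      (by rw [← hfn]; exact natDegree_lt_natDegree h hp) ⟨p, h, he, rfl⟩
  clear hfn
  set n := f.natDegree with hn
  have hdeg : f.degree = n := degree_eq_natDegree hf0
  rw [hdeg] at hmin
  have hn0 : 0 < n := by
    rw [Nat.pos_iff_ne_zero]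
    intro h
    have := eq_C_of_natDegree_eq_zero (hn ▸ h)
    rw [this, evC] at hfe
    have := hι (hfe.trans (map_zero ι).symm)
    apply hf0; rw [‹f = _›, this, C_0]
  have hr0 : f.coeff 0 ≠ 0 := by
    intro h
    have h1 := divX_mul_X_add f
    rw [h, C_0, add_zero] at h1
    have h2 : ev f.divX = 0 := by
      rw [← h1, map_mul, evX] at hfe
      exact (mul_eq_zero.1 hfe).resolve_right ht
    have := hmin _ (hdeg ▸ degree_divX_lt hf0) h2
    rw [this, zero_mul] at h1
    exact hf0 h1.symm
  let V : AddSubgroup D :=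
    { carrier := {d | ∃ p : A[X], p.degree < n ∧ ev p = d}
      zero_mem' := ⟨0, by simp⟩
      add_mem' := by
        rintro a b ⟨p, hp, rfl⟩ ⟨q, hq, rfl⟩
        exact ⟨p + q, (degree_add_le _ _).trans_lt (max_lt hp hq), map_add _ _ _⟩
      neg_mem' := by
        rintro a ⟨p, hp, rfl⟩
        exact ⟨-p, by rwa [degree_neg], map_neg _ _⟩ }
  have VC : ∀ a, ι a ∈ V := fun a =>
    ⟨C a, degree_C_le.trans_lt (by exact_mod_cast hn0), evC a⟩
  have Vl : ∀ a, ∀ v ∈ V, ι a * v ∈ V := by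
    rintro a v ⟨p, hp, rfl⟩
    refine ⟨C a * p, ?_, by rw [map_mul, evC]⟩
    rw [degree_lt_iff_coeff_zero] at hp ⊢
    intro m hm
    rw [coeff_C_mul, hp m hm, mul_zero]
  have Vr : ∀ a, ∀ v ∈ V, v * ι a ∈ V := by
    rintro a v ⟨p, hp, rfl⟩
    refine ⟨p * C a, ?_, by rw [map_mul, evC]⟩
    rw [degree_lt_iff_coeff_zero] at hp ⊢
    intro m hm
    rw [coeff_mul_C, hp m hm, zero_mul]
  have Vt : ∀ y, t ^ n * ι y ∈ V → ∀ v ∈ V, t * v * ι y ∈ V := by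
    rintro y hy v ⟨p, hp, rfl⟩
    have h1 := monomial_add_erase (X * p) n
    have h2 : (X * p).degree < ((n + 1 : ℕ) : WithBot ℕ) := by
      rw [degree_lt_iff_coeff_zero] at hp ⊢
      intro m hm
      obtain ⟨m, rfl⟩ : ∃ m', m = m' + 1 := ⟨m - 1, by omega⟩
      rw [coeff_X_mul, hp m (by omega)]
    rw [← evX, ← map_mul, ← h1, map_add, add_mul]
    refine V.add_mem ?_ (Vr _ _ ⟨_, erase_lt _ _ h2, rfl⟩)
    rw [← C_mul_X_pow_eq_monomial, map_mul, evC, map_pow, evX, mul_assoc]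
    exact Vl _ _ hy
  have Vti : ∀ y, t⁻¹ * ι y ∈ V → ∀ v ∈ V, t⁻¹ * v * ι y ∈ V := by
    rintro y hy v ⟨p, hp, rfl⟩
    rw [← X_mul_divX_add p, map_add, map_mul, evX, evC, mul_add, ← mul_assoc,
      inv_mul_cancel₀ ht, one_mul, add_mul]
    refine V.add_mem (Vr _ _ ⟨_, ?_, rfl⟩) ?_
    · rw [degree_lt_iff_coeff_zero] at hp ⊢
      intro m hm
      rw [coeff_divX, hp _ (by omega)]
    · rw [← (hti _).eq, mul_assoc]
      exact Vl _ _ hy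
  refine ⟨fun y => t ^ n * ι y ∈ V ∧ t⁻¹ * ι y ∈ V, ?_, ?_, ?_⟩
  · refine ⟨f.leadingCoeff * f.coeff 0, ⟨?_, ?_⟩, ?_⟩
    · rw [map_mul, ← mul_assoc]
      refine Vr _ _ ⟨-f.eraseLead, ?_, ?_⟩
      · rw [degree_neg, ← hdeg]; exact degree_eraseLead_lt hf0
      · have := eraseLead_add_C_mul_X_pow f
        rw [← this, map_add, map_mul, evC, map_pow, evX, ((hc _).pow_right _).eq] at hfe
        rw [map_neg]
        exact (eq_neg_of_add_eq_zero_right hfe).symm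
    · rw [map_mul, ← mul_assoc, ← (hti _).eq, mul_assoc]
      refine Vl _ _ ⟨-f.divX, ?_, ?_⟩
      · rw [degree_neg, ← hdeg]; exact degree_divX_lt hf0
      · rw [← X_mul_divX_add f, map_add, map_mul, evC, evX] at hfe
        rw [eq_neg_of_add_eq_zero_right hfe, mul_neg, ← mul_assoc, inv_mul_cancel₀ ht, one_mul,
          map_neg]
    · intro h
      have := congrArg ι h
      rw [map_mul, map_zero, mul_eq_zero, map_eq_zero_iff ι hι, map_eq_zero_iff ι hι] at this
      exact this.elim (fun h => hf0 (leadingCoeff_eq_zero.1 h)) hr0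
  · rintro y a ⟨h1, h2⟩
    simp only [map_mul, ← mul_assoc]
    exact ⟨Vr _ _ h1, Vr _ _ h2⟩
  · rintro y ⟨h1, h2⟩ d hd
    let W : AddSubgroup D :=
      { carrier := {d | ∃ k : ℕ, ∀ l, k ≤ l → d * ι y ^ l ∈ V}
        zero_mem' := ⟨0, fun l _ => by rw [zero_mul]; exact V.zero_mem⟩
        add_mem' := by
          rintro a b ⟨k, hk⟩ ⟨k', hk'⟩
          refine ⟨k + k', fun l hl => ?_⟩
          rw [add_mul]
          exact V.add_mem (hk _ (by omega)) (hk' _ (by omega))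
        neg_mem' := by
          rintro a ⟨k, hk⟩
          refine ⟨k, fun l hl => ?_⟩
          rw [neg_mul]
          exact V.neg_mem (hk _ hl) }
    obtain ⟨k, hk⟩ := hspan W
      (fun a => ⟨0, fun l _ => by rw [← map_pow, ← map_mul]; exact VC _⟩)
      (by
        rintro w ⟨k, hk⟩
        refine ⟨k + 1, fun l hl => ?_⟩
        obtain ⟨l, rfl⟩ : ∃ m', l = m' + 1 := ⟨l - 1, by omega⟩
        rw [pow_succ, ← mul_assoc, mul_assoc t]
        exact Vt _ h1 _ (hk _ (by omega)))
      (by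
        rintro w ⟨k, hk⟩
        refine ⟨k + 1, fun l hl => ?_⟩
        obtain ⟨l, rfl⟩ : ∃ m', l = m' + 1 := ⟨l - 1, by omega⟩
        rw [pow_succ, ← mul_assoc, mul_assoc t⁻¹]
        exact Vti _ h2 _ (hk _ (by omega)))
      ((ι d)⁻¹)
    obtain ⟨p, hp, hpe⟩ := hk k le_rfl
    have hd' : ι d ≠ 0 := by rwa [Ne, map_eq_zero_iff ι hι]
    have h3 : C d * p - C (y ^ k) = 0 := by
      apply hmin
      · rw [degree_lt_iff_coeff_zero] at hp ⊢
        intro m hm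
        rw [coeff_sub, coeff_C_mul, hp m hm, mul_zero, coeff_C_of_ne_zero (by omega), sub_zero]
      · rw [map_sub, map_mul, evC, evC, hpe, ← mul_assoc, mul_inv_cancel₀ hd', one_mul, map_pow,
          sub_self]
    refine ⟨k, p.coeff 0, ?_⟩
    have := congrArg (fun p => coeff p 0) h3
    simp only [coeff_sub, coeff_C_mul, coeff_C_zero, coeff_zero] at this
    exact (sub_eq_zero.1 this).symm
end Core
section QD

theorem exists_max_right {S : Type*} [Ring S] (a b : S) (h : ∀ u v, a * u + b * v ≠ 1) :
    ∃ M : Submodule Sᵐᵒᵖ S, IsCoatom M ∧ a ∈ M ∧ b ∈ M := by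
  have : Module.Finite Sᵐᵒᵖ S := by
    refine ⟨⟨{1}, ?_⟩⟩
    rw [eq_top_iff]
    intro x _
    have : x = MulOpposite.op x • (1 : S) := by simp
    rw [this]
    exact Submodule.smul_mem _ _ (Submodule.subset_span (by simp))
  have hne : Submodule.span Sᵐᵒᵖ {a, b} ≠ ⊤ := by
    intro ht
    have h1 : (1 : S) ∈ Submodule.span Sᵐᵒᵖ {a, b} := by rw [ht]; trivial
    obtain ⟨u, v, huv⟩ := Submodule.mem_span_pair.1 h1
    exact h u.unop v.unop (by simpa [MulOpposite.smul_eq_mul_unop] using huv)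
  obtain h1 | ⟨M, hM, hle⟩ := IsCoatomic.eq_top_or_exists_le_coatom (Submodule.span Sᵐᵒᵖ {a, b})
  · exact (hne h1).elim
  · exact ⟨M, hM, hle (Submodule.subset_span (by simp)), hle (Submodule.subset_span (by simp))⟩

theorem right_mul_mem {S : Type*} [Ring S] (M : Submodule Sᵐᵒᵖ S) {x : S} (hx : x ∈ M) (r : S) :
    x * r ∈ M := by
  simpa using M.smul_mem (MulOpposite.op r) hx

theorem one_not_mem {S : Type*} [Ring S] (M : Submodule Sᵐᵒᵖ S) (hM : IsCoatom M) :
    (1 : S) ∉ M := by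
  intro h
  apply hM.1
  rw [eq_top_iff]
  intro x _
  simpa using right_mul_mem M h x

theorem max_right_inv {S : Type*} [Ring S] (M : Submodule Sᵐᵒᵖ S) (hM : IsCoatom M) {x : S}
    (hx : x ∉ M) : ∃ m ∈ M, ∃ s, m + x * s = 1 := by
  have h1 : M ⊔ Submodule.span Sᵐᵒᵖ {x} = ⊤ := by
    apply hM.2
    rw [left_lt_sup]
    intro h
    exact hx (h (Submodule.subset_span (by simp)))
  have h2 : (1 : S) ∈ M ⊔ Submodule.span Sᵐᵒᵖ {x} := by rw [h1]; trivial
  obtain ⟨m, hm, z, hz, h3⟩ := Submodule.mem_sup.1 h2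
  obtain ⟨s, rfl⟩ := Submodule.mem_span_singleton.1 hz
  exact ⟨m, hm, s.unop, by simpa [MulOpposite.smul_eq_mul_unop] using h3⟩

/-- Elementwise right quasi-duo criterion. -/
def RC (S : Type*) [Ring S] : Prop := ∀ a r : S, ∃ u v, a * u + (1 - r * a) * v = 1
/-- Elementwise left quasi-duo criterion. -/
def LC (S : Type*) [Ring S] : Prop := ∀ a r : S, ∃ u v, u * a + v * (1 - a * r) = 1
/-- Commutators are right quasi-regular. -/
def CR (S : Type*) [Ring S] : Prop := ∀ f g s : S, ∃ v, (1 + (f * g - g * f) * s) * v = 1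
/-- Commutators are left quasi-regular. -/
def CL (S : Type*) [Ring S] : Prop := ∀ f g s : S, ∃ v, v * (1 + s * (f * g - g * f)) = 1

theorem rqd_iff_s19 (S : Type*) [Ring S] : RightQuasiDuo S ↔ RC S := by
  constructor
  · intro h a r
    by_contra! hc
    obtain ⟨M, hM, h1, h2⟩ := exists_max_right _ _ hc
    apply one_not_mem M hM
    have := M.add_mem h2 (h M hM r a h1)
    simpa using this
  · intro h M hM r x hx
    by_contra hn
    obtain ⟨m, hm, s, hs⟩ := max_right_inv M hM hn
    obtain ⟨u, v, huv⟩ := h (x * s) r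
    apply one_not_mem M hM
    rw [← huv]
    refine M.add_mem (right_mul_mem M (right_mul_mem M hx _) _) (right_mul_mem M ?_ _)
    rw [← mul_assoc, ← hs]
    simpa using hm

theorem rc_op_iff (S : Type*) [Ring S] : RC Sᵐᵒᵖ ↔ LC S := by
  constructor
  · intro h a r
    obtain ⟨u, v, huv⟩ := h (MulOpposite.op a) (MulOpposite.op r)
    exact ⟨u.unop, v.unop, by simpa using congrArg MulOpposite.unop huv⟩
  · intro h a r
    obtain ⟨u, v, huv⟩ := h a.unop r.unop
    exact ⟨.op u, .op v, MulOpposite.unop_injective (by simpa using huv)⟩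

theorem cr_op (S : Type*) [Ring S] (h : CR Sᵐᵒᵖ) : CL S := by
  intro f g s
  obtain ⟨v, hv⟩ := h (.op g) (.op f) (.op s)
  exact ⟨v.unop, by simpa using congrArg MulOpposite.unop hv⟩

theorem rc_surj {S S' : Type*} [Ring S] [Ring S'] (φ : S →+* S') (hφ : Function.Surjective φ)
    (h : RC S) : RC S' := by
  intro a r
  obtain ⟨a, rfl⟩ := hφ a
  obtain ⟨r, rfl⟩ := hφ r
  obtain ⟨u, v, huv⟩ := h a r
  exact ⟨φ u, φ v, by simpa using congrArg φ huv⟩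

theorem cr_surj {S S' : Type*} [Ring S] [Ring S'] (φ : S →+* S') (hφ : Function.Surjective φ)
    (h : CR S) : CR S' := by
  intro a r s
  obtain ⟨a, rfl⟩ := hφ a
  obtain ⟨r, rfl⟩ := hφ r
  obtain ⟨s, rfl⟩ := hφ s
  obtain ⟨v, huv⟩ := h a r s
  exact ⟨φ v, by simpa using congrArg φ huv⟩

theorem cr_lc (S : Type*) [Ring S] (h : CR S) : LC S := by
  intro a r
  obtain ⟨v, hv⟩ := h r a 1
  rw [mul_one] at hv
  obtain ⟨u, hu⟩ := h r a (-v)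
  have h1 : 1 + (r * a - a * r) * (-v) = v := by
    rw [← hv]; noncomm_ring
  rw [h1] at hu
  have h2 : v * (1 + (r * a - a * r)) = 1 := by
    have := left_inv_eq_right_inv hv hu
    rw [this]; exact hu
  exact ⟨v * r, v, by refine Eq.trans ?_ h2; noncomm_ring⟩

theorem cl_rc (S : Type*) [Ring S] (h : CL S) : RC S := by
  intro a r
  obtain ⟨v, hv⟩ := h a r 1
  rw [one_mul] at hv
  obtain ⟨u, hu⟩ := h a r (-v)
  have h1 : 1 + (-v) * (a * r - r * a) = v := by
    rw [← hv]; noncomm_ring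
  rw [h1] at hu
  have h2 : (1 + (a * r - r * a)) * v = 1 := by
    have := left_inv_eq_right_inv hu hv
    rw [← this]; exact hu
  exact ⟨r * v, v, by refine Eq.trans ?_ h2; noncomm_ring⟩

theorem cl_iff (S : Type*) [Ring S] :
    CL S ↔ ∀ f g : S, f * g - g * f ∈ Ideal.jacobson (⊥ : Ideal S) := by
  simp only [Ideal.mem_jacobson_iff, Ideal.mem_bot, sub_eq_zero, CL]
  have : ∀ z y x : S, z * y * x + z = z * (1 + y * x) := fun z y x => by noncomm_ring
  simp only [this]

theorem lqd_iff_lc (S : Type*) [Ring S] : LeftQuasiDuo S ↔ LC S := by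
  constructor
  · intro h a r
    by_contra! hc
    have hne : Ideal.span {a, 1 - a * r} ≠ ⊤ := by
      intro ht
      rw [Ideal.eq_top_iff_one, Ideal.mem_span_pair] at ht
      obtain ⟨u, v, huv⟩ := ht
      exact hc u v huv
    obtain ⟨M, hM, hle⟩ := Ideal.exists_le_maximal _ hne
    apply hM.ne_top
    rw [Ideal.eq_top_iff_one]
    have h1 : a ∈ M := hle (Ideal.subset_span (by simp))
    have h2 : 1 - a * r ∈ M := hle (Ideal.subset_span (by simp))
    simpa using M.add_mem h2 (h M hM.out r a h1)
  · intro h M hM r x hx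
    by_contra hn
    have hM' : Ideal.IsMaximal M := ⟨hM⟩
    obtain ⟨s, hs⟩ := hM'.exists_inv hn
    obtain ⟨m, hm, hs⟩ := hs
    obtain ⟨u, v, huv⟩ := h (s * x) r
    apply hM'.ne_top
    rw [Ideal.eq_top_iff_one, ← huv]
    refine M.add_mem (M.smul_mem u (M.smul_mem s hx)) (M.smul_mem v ?_)
    rw [← hs, mul_assoc]
    simpa using hm
end QD
section Main
open LaurentPolynomial

theorem not_right_inv {A : Type*} [Ring A] (y : A) (hy : ∀ k : ℕ, y ^ k ≠ 0)
    (g : A[T;T⁻¹]) : (1 - C y * T 1) * g ≠ 1 := by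
  intro h
  obtain ⟨k, p, hp⟩ := exists_T_pow g
  have h1 : (1 - Polynomial.C y * Polynomial.X) * p = Polynomial.X ^ k := by
    apply Polynomial.toLaurent_injective
    rw [map_mul, hp, ← mul_assoc, map_sub, map_mul]
    simp only [Polynomial.toLaurent_C, Polynomial.toLaurent_X, map_one, h, one_mul,
      Polynomial.toLaurent_X_pow]
  have h0 : p.coeff 0 = if 0 = k then 1 else 0 := by
    have := congrArg (fun q => Polynomial.coeff q 0) h1
    simpa [sub_mul, mul_assoc, Polynomial.coeff_X_pow] using this
  have hs : ∀ n, p.coeff (n + 1) - y * p.coeff n = if n + 1 = k then 1 else 0 := by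
    intro n
    have := congrArg (fun q => Polynomial.coeff q (n + 1)) h1
    simpa [sub_mul, mul_assoc, Polynomial.coeff_X_pow] using this
  have h2 : ∀ n, n < k → p.coeff n = 0 := by
    intro n
    induction n with
    | zero => intro hk; rw [h0, if_neg (by omega)]
    | succ n ih =>
      intro hk
      have := hs n
      rw [ih (by omega), if_neg (by omega), mul_zero, sub_zero] at this
      exact this
  have h3 : ∀ j, p.coeff (k + j) = y ^ j := by
    intro j
    induction j with
    | zero =>
      cases k with
      | zero => rw [add_zero, h0, if_pos rfl, pow_zero]
      | succ k =>
        have := hs k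
        rw [h2 k (by omega), mul_zero, sub_zero, if_pos rfl] at this
        rw [add_zero, this, pow_zero]
    | succ j ih =>
      have := hs (k + j)
      rw [ih, if_neg (by omega), sub_eq_zero] at this
      rw [← add_assoc, this, pow_succ']
  apply hy (p.natDegree + 1)
  rw [← h3]
  exact Polynomial.coeff_eq_zero_of_natDegree_lt (by omega)

theorem core_comm {A D : Type*} [Ring A] [DivisionRing D] (ι : A →+* D)
    (hι : Function.Injective ι) (t : D) (ht : t ≠ 0) (hc : ∀ a, Commute (ι a) t)
    (hspan : ∀ W : AddSubgroup D, (∀ a, ι a ∈ W) → (∀ w ∈ W, t * w ∈ W) →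
      (∀ w ∈ W, t⁻¹ * w ∈ W) → ∀ d, d ∈ W) (hq : RC A[T;T⁻¹]) (a b : A) : a * b = b * a := by
  obtain ⟨J, ⟨y, hJ, hy⟩, hJm, hJk⟩ := core_alg ι hι t ht hc hspan
  have hdom : NoZeroDivisors A := hι.noZeroDivisors ι (map_zero ι) (map_mul ι)
  have hnt : Nontrivial A := ⟨0, 1, fun h => by simpa using congrArg ι h⟩
  have hq' := (rqd_iff_s19 _).2 hq
  have hcen : ∀ y, J y → ∀ b, b * y = y * b := by
    intro y hJ b
    by_cases hy : y = 0
    · simp [hy]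
    by_contra hne
    obtain ⟨k, a, hk⟩ := hJk y hJ (b * y - y * b) (sub_ne_zero.2 hne)
    obtain ⟨M, hM, h1, -⟩ := exists_max_right (1 - C y * T 1 : A[T;T⁻¹]) 0 (fun u v h => by
      rw [zero_mul, add_zero] at h
      exact not_right_inv y (fun k => pow_ne_zero k hy) u h)
    have hl := hq' M hM
    have h2 : C (b * y - y * b) ∈ M := by
      have h3 := M.sub_mem (right_mul_mem M h1 (C b)) (hl (C b) _ h1)
      have h4 : (1 - C y * T 1) * C b - C b * (1 - C y * T 1) = C (b * y - y * b) * T 1 := by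
        rw [map_sub, map_mul, map_mul, sub_mul, mul_sub, mul_assoc (C y), T_mul 1 (C b), sub_mul]
        noncomm_ring
      rw [h4] at h3
      have h5 := right_mul_mem M h3 (T (-1))
      rwa [mul_assoc, ← T_add, add_neg_cancel, T_zero, mul_one] at h5
    have h6 : ∀ j : ℕ, C (y ^ j) ∉ M := by
      intro j
      induction j with
      | zero => rw [pow_zero, map_one]; exact one_not_mem M hM
      | succ j ih =>
        intro h
        apply ih
        have h7 := right_mul_mem M h (T 1)
        have h8 := M.add_mem (hl (C (y ^ j)) _ h1) h7
        have h9 : C (y ^ j) * (1 - C y * T 1) + C (y ^ (j + 1)) * T 1 = C (y ^ j) := by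
          rw [pow_succ, map_mul]
          noncomm_ring
        rwa [h9] at h8
    apply h6 k
    rw [hk, map_mul]
    exact right_mul_mem M h2 _
  have h1 := hcen _ (hJm y a hJ) b
  have h2 := hcen _ hJ b
  rw [← mul_assoc, h2, mul_assoc, mul_assoc] at h1
  exact (mul_left_cancel₀ hy h1).symm

theorem core_laurent (R : Type*) [Ring R] (hq : RC R[T;T⁻¹]) : CR R[T;T⁻¹] := by
  intro f g s
  by_contra! hcon
  obtain ⟨M, hM, h1, -⟩ := exists_max_right (1 + (f * g - g * f) * s) 0 (fun u v h => by
      rw [zero_mul, add_zero] at h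
      exact hcon u h)
  have hl := (rqd_iff_s19 _).2 hq M hM
  let I : Ideal R[T;T⁻¹] :=
    { carrier := M
      zero_mem' := M.zero_mem
      add_mem' := M.add_mem
      smul_mem' := fun r x hx => hl r x hx }
  have hI : I.IsTwoSided := ⟨fun b h => right_mul_mem M h b⟩
  let π : R[T;T⁻¹] →+* R[T;T⁻¹] ⧸ I := Ideal.Quotient.mk I
  have hπ : Function.Surjective π := Ideal.Quotient.mk_surjective
  have hker : ∀ x, π x = 0 ↔ x ∈ M := fun x => Ideal.Quotient.eq_zero_iff_mem
  have hrinv : ∀ x : R[T;T⁻¹] ⧸ I, x ≠ 0 → ∃ z, x * z = 1 := by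
    intro x hx
    obtain ⟨x, rfl⟩ := hπ x
    rw [Ne, hker] at hx
    obtain ⟨m, hm, s, hs⟩ := max_right_inv M hM hx
    refine ⟨π s, ?_⟩
    rw [← hker] at hm
    rw [← map_mul, ← map_one π, ← hs, map_add, hm, zero_add]
  have hnt : Nontrivial (R[T;T⁻¹] ⧸ I) := by
    refine ⟨π 1, 0, ?_⟩
    rw [Ne, hker]
    exact one_not_mem M hM
  have hunit : ∀ x : R[T;T⁻¹] ⧸ I, IsUnit x ∨ x = 0 := by
    intro x
    by_cases hx : x = 0
    · exact Or.inr hx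
    left
    obtain ⟨z, hz⟩ := hrinv x hx
    have hz0 : z ≠ 0 := by
      rintro rfl
      simp at hz
    obtain ⟨w, hw⟩ := hrinv z hz0
    have : x = w := left_inv_eq_right_inv hz hw
    exact ⟨⟨x, z, hz, by rw [this]; exact hw⟩, rfl⟩
  let _ : DivisionRing (R[T;T⁻¹] ⧸ I) := DivisionRing.ofIsUnitOrEqZero hunit
  let φ : R →+* R[T;T⁻¹] ⧸ I := π.comp C
  have ht1 : π (T 1) * π (T (-1)) = 1 := by
    rw [← map_mul, ← T_add, add_neg_cancel, T_zero, map_one]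
  have ht : π (T 1) ≠ 0 := left_ne_zero_of_mul_eq_one ht1
  have hti : (π (T 1))⁻¹ = π (T (-1)) := inv_eq_of_mul_eq_one_right ht1
  have hTc : ∀ n d, Commute (π (T n)) d := by
    intro n d
    obtain ⟨d, rfl⟩ := hπ d
    exact (commute_T n d).map π
  have hspan : ∀ W : AddSubgroup (R[T;T⁻¹] ⧸ I), (∀ a : φ.range, φ.range.subtype a ∈ W) →
      (∀ w ∈ W, π (T 1) * w ∈ W) → (∀ w ∈ W, (π (T 1))⁻¹ * w ∈ W) → ∀ d, d ∈ W := by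
    intro W hW1 hW2 hW3 d
    obtain ⟨d, rfl⟩ := hπ d
    rw [hti] at hW3
    induction d using LaurentPolynomial.induction_on with
    | h_C a => exact hW1 ⟨φ a, a, rfl⟩
    | h_add hp hq => rw [map_add]; exact W.add_mem hp hq
    | h_C_mul_T n a ih =>
      rw [T_add, ← mul_assoc, ← T_mul, map_mul]
      exact hW2 _ ih
    | h_C_mul_T_Z n a ih =>
      rw [T_sub, ← mul_assoc, ← T_mul, map_mul]
      exact hW3 _ ih
  have hqA : RC (φ.range)[T;T⁻¹] := by
    refine rc_surj (AddMonoidAlgebra.mapRingHom ℤ φ.rangeRestrict) ?_ hq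
    intro p
    induction p using LaurentPolynomial.induction_on' with
    | add p q hp hq =>
      obtain ⟨p, rfl⟩ := hp
      obtain ⟨q, rfl⟩ := hq
      exact ⟨p + q, map_add _ _ _⟩
    | C_mul_T n a =>
      obtain ⟨a, rfl⟩ := φ.rangeRestrict_surjective a
      refine ⟨C a * T n, ?_⟩
      rw [← single_eq_C_mul_T, ← single_eq_C_mul_T]
      exact AddMonoidAlgebra.mapRingHom_single _ _ _
  have hcomm := core_comm φ.range.subtype Subtype.val_injective (π (T 1)) ht
    (fun a => (hTc _ _).symm) hspan hqA
  have hR : ∀ a b : R, Commute (φ a) (φ b) := fun a b =>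
    congrArg Subtype.val (hcomm ⟨φ a, a, rfl⟩ ⟨φ b, b, rfl⟩)
  have hcD : ∀ f g : R[T;T⁻¹], Commute (π f) (π g) := by
    intro f g
    induction f using LaurentPolynomial.induction_on' with
    | add p q hp hq => rw [map_add]; exact hp.add_left hq
    | C_mul_T n a =>
      rw [map_mul]
      refine Commute.mul_left ?_ (hTc _ _)
      induction g using LaurentPolynomial.induction_on' with
      | add p q hp hq => rw [map_add]; exact hp.add_right hq
      | C_mul_T m b =>
        rw [map_mul]
        exact Commute.mul_right (hR a b) (hTc _ _).symm
  apply one_not_mem M hM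
  rw [← hker] at h1 ⊢
  rw [map_add, map_mul, map_sub, map_mul, map_mul, (hcD f g).eq, sub_self, zero_mul,
    add_zero] at h1
  exact h1

theorem core_left (R : Type*) [Ring R] (hq : LC R[T;T⁻¹]) : CL R[T;T⁻¹] := by
  let e : R[T;T⁻¹]ᵐᵒᵖ ≃+* Rᵐᵒᵖ[T;T⁻¹] :=
    AddMonoidAlgebra.opRingEquiv.trans
      (AddMonoidAlgebra.mapDomainRingEquiv Rᵐᵒᵖ
        (AddOpposite.opAddEquiv (M := ℤ)).symm)
  have h1 := (rc_op_iff _).2 hq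
  have h2 := rc_surj e.toRingHom e.surjective h1
  have h3 := core_laurent _ h2
  exact cr_op _ (cr_surj e.symm.toRingHom e.symm.surjective h3)
end Main

theorem stmt19 (R : Type*) [Ring R] :
    (RightQuasiDuo (LaurentPolynomial R) ↔
      ∀ f g : LaurentPolynomial R,
        f * g - g * f ∈ Ideal.jacobson (⊥ : Ideal (LaurentPolynomial R))) ∧
    (RightQuasiDuo (LaurentPolynomial R) ↔ LeftQuasiDuo (LaurentPolynomial R)) := by

  have h1 := core_laurent R
  have h2 := core_left R
  have h3 := cr_lc (LaurentPolynomial R)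
  have h4 := cl_rc (LaurentPolynomial R)
  rw [← cl_iff, rqd_iff_s19, lqd_iff_lc]
  exact ⟨⟨fun h => h2 (h3 (h1 h)), h4⟩, ⟨fun h => h3 (h1 h), fun h => h4 (h2 h)⟩⟩
end
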